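/- Let n be a positive integer, let q_1, …, q_{n+1} be positive integers with 2q_j dividing q_{j+1} for j = 1, …, n, and let p be an integer coprime to q_{n+1}. Define N_n(x) = #{k ∈ {1, …, q_{n+1}} : m_n(x + k·p/q_{n+1}) = m_n(x)} for x ∈ 𝕋. Then ∫_𝕋 N_n dλ = q_{n+1}·C(2n, n)/2^{2n}. -/

import Mathlib

open MeasureTheory

/-- The Haar function `T : 𝕋 → ℤ`, equal to `1` on `[0,1/2)` and `-1` on `[1/2,1)`. -/
noncomputable def haarT (x : UnitAddCircle) : ℤ :=
  if (AddCircle.equivIco 1 0 x : ℝ) < 1/2 then 1 else -1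

/-- `m_n(x) = T(q_1 x) + ⋯ + T(q_n x)` (here `q j`, `j < n`, stands for the paper's `q_{j+1}`). -/
noncomputable def mSum (q : ℕ → ℕ) (n : ℕ) (x : UnitAddCircle) : ℤ :=
  ∑ j ∈ Finset.range n, haarT (q j • x)

/-- The counting function
`N_n(x) = #{k ∈ {1, …, q_{n+1}} : m_n(x + k·p/q_{n+1}) = m_n(x)}`
(here `q n` is the paper's `q_{n+1}`). -/
noncomputable def countN (q : ℕ → ℕ) (n : ℕ) (p : ℤ) (x : UnitAddCircle) : ℕ :=
  {k : ℕ | k ∈ Finset.Icc 1 (q n) ∧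
    mSum q n (x + (((k : ℝ) * (p : ℝ) / (q n : ℝ) : ℝ) : UnitAddCircle)) = mSum q n x}.ncard

theorem haarT_coe (b : ℝ) : haarT (b : UnitAddCircle) = if Int.fract b < 1 / 2 then 1 else -1 := by
  simp [haarT, AddCircle.coe_equivIco_mk_apply]

theorem haarT_add_half (y : UnitAddCircle) :
    haarT (y + ((1 / 2 : ℝ) : UnitAddCircle)) = -haarT y := by
  induction y using QuotientAddGroup.induction_on with
  | H b =>
    change haarT ((b : UnitAddCircle) + ((1 / 2 : ℝ) : UnitAddCircle)) = -haarT (b : UnitAddCircle)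
    rw [← AddCircle.coe_add, haarT_coe, haarT_coe]
    have h0 := Int.fract_nonneg b
    have h1 := Int.fract_lt_one b
    by_cases h : Int.fract b < 1 / 2
    · have h2 : Int.fract (b + 1 / 2) = Int.fract b + 1 / 2 := by
        rw [Int.fract_eq_iff]
        refine ⟨by linarith, by linarith, ⌊b⌋, ?_⟩
        rw [← Int.self_sub_floor]; ring
      rw [h2, if_pos h, if_neg (by linarith)]
    · have h2 : Int.fract (b + 1 / 2) = Int.fract b - 1 / 2 := by
        rw [Int.fract_eq_iff]
        refine ⟨by linarith, by linarith, ⌊b⌋ + 1, ?_⟩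
        rw [← Int.self_sub_floor]; push_cast; ring
      rw [h2, if_neg h, if_pos (by linarith)]; rfl

theorem measurable_haarT : Measurable haarT := by
  unfold haarT
  refine Measurable.ite ?_ measurable_const measurable_const
  exact measurableSet_lt
    (measurable_subtype_coe.comp (AddCircle.measurableEquivIco 1 0).measurable) measurable_const

theorem measurable_mSum (q : ℕ → ℕ) (n : ℕ) : Measurable (mSum q n) := by
  unfold mSum
  exact Finset.measurable_fun_sum _ fun j _ =>
    measurable_haarT.comp (continuous_nsmul (q j)).measurable

/-- Along the translates of `y` by multiples of `1 / (2r)`, the Haar function takes each of its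
values `r` times. -/
theorem sum_haarT_translates (r : ℕ) (hr : 0 < r) (h : ℤ → ℝ) (y : UnitAddCircle) :
    ∑ l ∈ Finset.range (2 * r), h (haarT (y + ((l / (2 * r : ℕ) : ℝ) : UnitAddCircle)))
      = r * (h 1 + h (-1)) := by
  have hr' : (r : ℝ) ≠ 0 := by positivity
  rw [two_mul, Finset.sum_range_add, ← Finset.sum_add_distrib]
  rw [Finset.sum_congr rfl (g := fun _ => h 1 + h (-1))]
  · simp [mul_add]
  intro l _
  have e : (((r + l : ℕ) : ℝ) / (r + r : ℕ)) = (l / (r + r : ℕ) : ℝ) + 1 / 2 := by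
    push_cast; field_simp; ring
  rw [e, AddCircle.coe_add, ← add_assoc, haarT_add_half]
  generalize y + _ = z
  unfold haarT
  split_ifs
  · rfl
  · simp [add_comm]

/-- Multiplication by `Q` forgets translations by multiples of `1 / Q`. -/
theorem nsmul_coe_div (Q j : ℕ) (hQ : 0 < Q) : Q • ((j / Q : ℝ) : UnitAddCircle) = 0 := by
  rw [← AddCircle.coe_nsmul, nsmul_eq_mul, mul_div_cancel₀ _ (by positivity)]
  rw [AddCircle.coe_eq_zero_iff]
  exact ⟨j, by simp⟩

theorem sum_choose_succ_signed (g : ℤ → ℝ) (n : ℕ) :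
    ∑ i ∈ Finset.range (n + 2), ((n + 1).choose i : ℝ) * g (2 * i - (n + 1 : ℕ))
      = ∑ i ∈ Finset.range (n + 1),
          (n.choose i : ℝ) * (g (2 * i - n + 1) + g (2 * i - n + -1)) := by
  rw [Finset.sum_choose_succ_mul (fun i _ => g (2 * i - (n + 1 : ℕ))) n,
    ← Finset.sum_add_distrib]
  refine Finset.sum_congr rfl fun i _ => ?_
  rw [← mul_add, add_comm (g (2 * i - n + 1))]
  congr 3 <;> push_cast <;> ring

theorem sum_range_mul_eq (a b : ℕ) (f : ℕ → ℝ) :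
    ∑ k ∈ Finset.range (a * b), f k
      = ∑ l ∈ Finset.range b, ∑ j ∈ Finset.range a, f (l + b * j) := by
  induction a with
  | zero => simp
  | succ a ih =>
    simp_rw [Finset.sum_range_succ, Finset.sum_add_distrib]
    rw [add_mul, one_mul, Finset.sum_range_add, ih]
    congr 1
    exact Finset.sum_congr rfl fun l _ => by rw [add_comm, mul_comm]

theorem sum_mSum_translates (q : ℕ → ℕ) (n : ℕ) (hq : ∀ j ≤ n, 0 < q j)
    (hdvd : ∀ j < n, 2 * q j ∣ q (j + 1)) (g : ℤ → ℝ) (x : UnitAddCircle) :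
    ∑ k ∈ Finset.range (q n), g (mSum q n (x + ((k / q n : ℝ) : UnitAddCircle)))
      = q n / 2 ^ n * ∑ i ∈ Finset.range (n + 1), (n.choose i : ℝ) * g (2 * i - n) := by
  induction n generalizing g x with
  | zero => simp [mSum]
  | succ n ih =>
    have hQ : 0 < q n := hq n (by omega)
    obtain ⟨r, hr⟩ := hdvd n (by omega)
    have hr0 : 0 < r := by
      have := hq (n + 1) le_rfl
      rw [hr] at this
      exact Nat.pos_of_mul_pos_left this
    have hQ' : (q n : ℝ) ≠ 0 := by positivity
    have hr' : (r : ℝ) ≠ 0 := by positivity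
    have key : ∀ l j : ℕ, mSum q (n + 1) (x + (((l + 2 * r * j : ℕ) / q (n + 1) : ℝ) : UnitAddCircle))
        = mSum q n (x + ((l / q (n + 1) : ℝ) : UnitAddCircle) + ((j / q n : ℝ) : UnitAddCircle))
          + haarT (q n • x + ((l / (2 * r : ℕ) : ℝ) : UnitAddCircle)) := by
      intro l j
      have e : (((l + 2 * r * j : ℕ) / q (n + 1) : ℝ) : UnitAddCircle)
          = ((l / q (n + 1) : ℝ) : UnitAddCircle) + ((j / q n : ℝ) : UnitAddCircle) := by
        rw [← AddCircle.coe_add, hr]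
        congr 1
        push_cast; field_simp
      rw [e, ← add_assoc, mSum, Finset.sum_range_succ, ← mSum]
      congr 2
      rw [smul_add, nsmul_coe_div _ _ hQ, add_zero, smul_add, ← AddCircle.coe_nsmul, hr]
      congr 2
      rw [nsmul_eq_mul]; push_cast; field_simp
    rw [show Finset.range (q (n + 1)) = Finset.range (q n * (2 * r)) by rw [hr]; congr 1; ring,
      sum_range_mul_eq]
    simp_rw [key]
    have step : ∀ l : ℕ, _ := fun l =>
      ih (fun j hj => hq j (by omega)) (fun j hj => hdvd j (by omega))
        (fun v => g (v + haarT (q n • x + ((l / (2 * r : ℕ) : ℝ) : UnitAddCircle))))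
        (x + ((l / q (n + 1) : ℝ) : UnitAddCircle))
    simp_rw [step]
    rw [← Finset.mul_sum, Finset.sum_comm, sum_choose_succ_signed]
    simp_rw [← Finset.mul_sum]
    have half : ∀ i : ℕ, _ := fun i : ℕ =>
      sum_haarT_translates r hr0 (fun t => g (2 * i - n + t)) (q n • x)
    simp_rw [half]
    rw [Finset.mul_sum, Finset.mul_sum]
    refine Finset.sum_congr rfl fun i _ => ?_
    rw [hr]; push_cast; field_simp; ring

theorem sum_range_zmod (Q : ℕ) [NeZero Q] (f : ZMod Q → ℝ) :
    ∑ k ∈ Finset.range Q, f k = ∑ a, f a :=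
  Finset.sum_nbij' (fun k => (k : ZMod Q)) ZMod.val (by simp) (by simp [ZMod.val_lt])
    (fun k hk => ZMod.val_cast_of_lt (Finset.mem_range.1 hk)) (by simp) (by simp)

theorem sum_Icc_zmod (Q : ℕ) [NeZero Q] (f : ZMod Q → ℝ) :
    ∑ k ∈ Finset.Icc 1 Q, f k = ∑ a, f a := by
  rw [← Equiv.sum_comp (Equiv.addRight (1 : ZMod Q)), ← sum_range_zmod,
    ← Finset.Ico_succ_right_eq_Icc, Finset.sum_Ico_eq_sum_range]
  simp [add_comm]

/-- Translating by the multiples of `p / Q` or of `1 / Q` gives the same sum, for `p` coprime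
to `Q`. -/
theorem sum_translates_coprime (Q : ℕ) (hQ : 0 < Q) (p : ℤ) (hp : IsCoprime p (Q : ℤ))
    (f : UnitAddCircle → ℝ) :
    ∑ k ∈ Finset.Icc 1 Q, f (((k : ℝ) * (p : ℝ) / (Q : ℝ) : ℝ) : UnitAddCircle)
      = ∑ k ∈ Finset.range Q, f ((k / Q : ℝ) : UnitAddCircle) := by
  have : NeZero Q := ⟨hQ.ne'⟩
  have hu : IsUnit (p : ZMod Q) := by
    obtain ⟨a, b, hab⟩ := hp
    have := congrArg (Int.cast : ℤ → ZMod Q) hab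
    push_cast at this
    rw [ZMod.natCast_self, mul_zero, add_zero] at this
    exact IsUnit.of_mul_eq_one_right _ this
  have h1 := sum_Icc_zmod Q fun a => f (ZMod.toAddCircle (a * (p : ZMod Q)))
  have h2 := sum_range_zmod Q fun a => f (ZMod.toAddCircle a)
  have h3 := Equiv.sum_comp (Units.mulRight hu.unit) fun a => f (ZMod.toAddCircle a)
  simp only [Units.mulRight_apply, IsUnit.unit_spec] at h3
  rw [h3, ← h2] at h1
  calc _ = _ := Finset.sum_congr rfl fun k _ => by
        rw [← Int.cast_natCast (R := ZMod Q), ← Int.cast_mul, ZMod.toAddCircle_intCast]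
        push_cast; rfl
    _ = _ := h1
    _ = _ := Finset.sum_congr rfl fun k _ => by rw [ZMod.toAddCircle_natCast]

/-- The distribution of the random walk `mSum q n` under Haar measure. -/
theorem integral_comp_mSum (q : ℕ → ℕ) (n : ℕ) (hq : ∀ j ≤ n, 0 < q j)
    (hdvd : ∀ j < n, 2 * q j ∣ q (j + 1)) (g : ℤ → ℝ)
    (hg : Integrable (fun x => g (mSum q n x)) (volume : Measure UnitAddCircle)) :
    ∫ x, g (mSum q n x) ∂(volume : Measure UnitAddCircle)
      = (∑ i ∈ Finset.range (n + 1), (n.choose i : ℝ) * g (2 * i - n)) / 2 ^ n := by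
  have hQ : (q n : ℝ) ≠ 0 := by have := hq n le_rfl; positivity
  have h := integral_finsetSum (μ := (volume : Measure UnitAddCircle)) (Finset.range (q n))
    (f := fun k x => g (mSum q n (x + ((k / q n : ℝ) : UnitAddCircle))))
    fun k _ => hg.comp_add_right _
  simp_rw [sum_mSum_translates q n hq hdvd g] at h
  have h' : ∀ k : ℕ, _ := fun k : ℕ => integral_add_right_eq_self
    (μ := (volume : Measure UnitAddCircle)) (fun x => g (mSum q n x))
    ((k / q n : ℝ) : UnitAddCircle)
  simp_rw [h'] at h
  simp only [integral_const, measureReal_def, UnitAddCircle.measure_univ, ENNReal.toReal_one,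
    one_smul, Finset.sum_const, Finset.card_range, nsmul_eq_mul] at h
  rw [← mul_right_inj' hQ, ← h]
  field_simp

theorem countN_eq (q : ℕ → ℕ) (n : ℕ) (hq : ∀ j ≤ n, 0 < q j)
    (hdvd : ∀ j < n, 2 * q j ∣ q (j + 1)) (p : ℤ) (hp : IsCoprime p (q n : ℤ))
    (x : UnitAddCircle) :
    (countN q n p x : ℝ) = q n / 2 ^ n * ∑ i ∈ Finset.range (n + 1),
      (n.choose i : ℝ) * if (2 * i - n : ℤ) = mSum q n x then 1 else 0 := by
  rw [← sum_mSum_translates q n hq hdvd (fun v => if v = mSum q n x then 1 else 0) x,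
    ← sum_translates_coprime (q n) (hq n le_rfl) p hp
      (fun t => if mSum q n (x + t) = mSum q n x then (1 : ℝ) else 0),
    Finset.sum_boole, countN, ← Set.ncard_coe_finset, Finset.coe_filter]

/-- for positive integers `q_1, …, q_{n+1}` (here `q j` is the paper's
`q_{j+1}`) with `2q_j ∣ q_{j+1}` and `p` coprime to `q_{n+1}`,
`∫_𝕋 N_n dλ = q_{n+1}·C(2n, n)/2^{2n}`. -/
theorem statement17 (n : ℕ) (hn : 0 < n) (q : ℕ → ℕ) (hq : ∀ j ≤ n, 0 < q j)
    (hdvd : ∀ j < n, 2 * q j ∣ q (j + 1))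
    (p : ℤ) (hp : IsCoprime p (q n : ℤ)) :
    (∫ x, (countN q n p x : ℝ) ∂(volume : Measure UnitAddCircle))
      = (q n : ℝ) * (Nat.choose (2 * n) n : ℝ) / 2 ^ (2 * n) := by
  simp_rw [countN_eq q n hq hdvd p hp]
  rw [integral_comp_mSum q n hq hdvd fun v => q n / 2 ^ n * ∑ i ∈ Finset.range (n + 1),
    (n.choose i : ℝ) * if (2 * i - n : ℤ) = v then 1 else 0]
  · have h : ∀ i ∈ Finset.range (n + 1), (n.choose i : ℝ) * (q n / 2 ^ n *
        ∑ j ∈ Finset.range (n + 1), (n.choose j : ℝ) *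
          if (2 * j - n : ℤ) = 2 * i - n then 1 else 0) = q n / 2 ^ n * (n.choose i : ℝ) ^ 2 := by
      intro i hi
      rw [Finset.sum_eq_single_of_mem i hi]
      · simp; ring
      · intro j _ hj
        rw [if_neg (by omega), mul_zero]
    rw [Finset.sum_congr rfl h, ← Finset.mul_sum, ← Nat.sum_range_choose_sq]
    push_cast
    rw [two_mul, pow_add]
    field_simp
  · refine (integrable_finsetSum _ fun i _ => Integrable.const_mul ?_ _).const_mul _
    refine Integrable.of_bound (C := 1) ?_ (Filter.Eventually.of_forall fun x => ?_)
    · exact ((measurable_of_countable fun v : ℤ => if (2 * i - n : ℤ) = v then (1 : ℝ) else 0).comp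
        (measurable_mSum q n)).aestronglyMeasurable
    · split_ifs <;> simp
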